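/- Optimal test/calculation mixing (arithmetic core of Lemma 12): Let c_calc, s_calc, c_test, s_test, δ be reals with 0 < δ < 1/6, c_calc − s_calc ≥ 1/3, 0 ≤ s_calc, 0 ≤ s_test ≤ c_test ≤ 1, and set q = (c_test − s_test)/(1 + c_test − s_test − s_calc − δ). Then the two gap expressions coincide at this q: q(c_calc − s_calc − δ) = q(c_calc − 1) + (1 − q)(c_test − s_test) = (c_calc − s_calc − δ)(c_test − s_test)/(1 + c_test − s_test − s_calc − δ), and this common value is at least (c_test − s_test)/12. -/

import Mathlib

/-- arithmetic core of the optimal test/calculation mixing.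
At q = (c_test − s_test)/(1 + c_test − s_test − s_calc − δ) the two gap expressions
coincide, equal the displayed closed form, and are at least (c_test − s_test)/12. -/
theorem optimal_mixing (cCalc sCalc cTest sTest δ : ℝ)
    (hδ0 : 0 < δ) (hδ : δ < 1 / 6)
    (hgap : 1 / 3 ≤ cCalc - sCalc)
    (hsCalc : 0 ≤ sCalc) (hcCalc : cCalc ≤ 1)
    (hsTest : 0 ≤ sTest) (hts : sTest ≤ cTest) (hcTest : cTest ≤ 1) :
    let q := (cTest - sTest) / (1 + cTest - sTest - sCalc - δ)
    q * (cCalc - sCalc - δ) = q * (cCalc - 1) + (1 - q) * (cTest - sTest) ∧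
    q * (cCalc - sCalc - δ) =
      (cCalc - sCalc - δ) * (cTest - sTest) / (1 + cTest - sTest - sCalc - δ) ∧
    (cTest - sTest) / 12 ≤ q * (cCalc - sCalc - δ) := by
  intro q
  have hD : 0 < 1 + cTest - sTest - sCalc - δ := by linarith
  have hq : q * (1 + cTest - sTest - sCalc - δ) = cTest - sTest :=
    div_mul_cancel₀ _ hD.ne'
  have hq0 : 0 ≤ q := div_nonneg (by linarith) hD.le
  refine ⟨by linarith, ?_, ?_⟩
  · rw [eq_div_iff hD.ne']
    linear_combination (cCalc - sCalc - δ) * hq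
  · have h : 0 ≤ q * (12 * (cCalc - sCalc - δ) - (1 + cTest - sTest - sCalc - δ)) :=
      mul_nonneg hq0 (by linarith)
    linarith
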